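/- arXiv:2006.03551 — 2 statements merged into one kernel-verified Lean document; each statement's English description precedes it below -/
import Mathlib

section
/- Let P be a Poisson algebra over a field 𝔽 that is solvable of derived length n as a Lie algebra. Then the Poisson ideal 𝒥 of P generated by all elements {{{x₁,x₂},{x₃,x₄}},x₅} with x₁,…,x₅ ∈ P is associative nilpotent of index bounded by a function depending only on n: there exists t (depending only on n) with 𝒥^t = 0. -/
/-- A Poisson bracket on a commutative associative unital `F`-algebra `P`:
an `F`-bilinear, alternating bracket satisfying the Jacobi identity and the
Leibniz rule `{a·b, c} = a·{b,c} + b·{a,c}`. -/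
structure PoissonBracket (F P : Type*) [Field F] [CommRing P] [Algebra F P] where
  bracket : P → P → P
  add_left : ∀ a b c : P, bracket (a + b) c = bracket a c + bracket b c
  smul_left : ∀ (r : F) (a b : P), bracket (r • a) b = r • bracket a b
  add_right : ∀ a b c : P, bracket a (b + c) = bracket a b + bracket a c
  smul_right : ∀ (r : F) (a b : P), bracket a (r • b) = r • bracket a b
  alt : ∀ a : P, bracket a a = 0
  jacobi : ∀ a b c : P,
    bracket (bracket a b) c + bracket (bracket b c) a + bracket (bracket c a) b = 0
  leibniz : ∀ a b c : P, bracket (a * b) c = a * bracket b c + b * bracket a c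

namespace PoissonBracket

variable {F P : Type*} [Field F] [CommRing P] [Algebra F P]

/-- `{A, B}`: the `F`-span of all brackets of elements of `A` with elements of `B`. -/
def lieSpan (pb : PoissonBracket F P) (A B : Submodule F P) : Submodule F P :=
  Submodule.span F {z : P | ∃ a ∈ A, ∃ b ∈ B, z = pb.bracket a b}

/-- Upper derived series: `δ̃₀(P) = P`, `δ̃ₙ₊₁(P) = {δ̃ₙ(P), δ̃ₙ(P)}·P`. -/
def udelta (pb : PoissonBracket F P) : ℕ → Submodule F P
  | 0 => ⊤
  | n + 1 => pb.lieSpan (pb.udelta n) (pb.udelta n) * ⊤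

/-- Derived series of a Lie ideal `I`: `δ₀(I) = I`, `δₙ₊₁(I) = {δₙ(I), δₙ(I)}`. -/
def dseries (pb : PoissonBracket F P) (I : Submodule F P) : ℕ → Submodule F P
  | 0 => I
  | n + 1 => pb.lieSpan (pb.dseries I n) (pb.dseries I n)

/-- Lower central series of a Lie ideal `I`, indexed so that `lcs I 1 = γ₁(I) = I`
and `lcs I (n+1) = γₙ₊₁(I) = {γₙ(I), I}` for `n ≥ 1` (index `0` is a dummy equal to `I`). -/
def lcs (pb : PoissonBracket F P) (I : Submodule F P) : ℕ → Submodule F P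
  | 0 => I
  | 1 => I
  | n + 2 => pb.lieSpan (pb.lcs I (n + 1)) I

/-- Upper Lie power series: `P⁽¹⁾ = P`, `P⁽ⁿ⁾ = {P⁽ⁿ⁻¹⁾, P}·P` for `n > 1`
(index `0` is a dummy equal to `P`). -/
def ulps (pb : PoissonBracket F P) : ℕ → Submodule F P
  | 0 => ⊤
  | 1 => ⊤
  | n + 2 => pb.lieSpan (pb.ulps (n + 1)) ⊤ * ⊤

/-- A Poisson ideal: an ideal for the associative product which is also a Lie ideal. -/
def IsPoissonIdeal (pb : PoissonBracket F P) (I : Submodule F P) : Prop :=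
  (∀ x ∈ I, ∀ p : P, p * x ∈ I) ∧ (∀ x ∈ I, ∀ p : P, pb.bracket x p ∈ I)

/-- The Poisson ideal generated by a set `S`: the smallest Poisson ideal containing `S`. -/
def poissonSpan (pb : PoissonBracket F P) (S : Set P) : Submodule F P :=
  sInf {I : Submodule F P | pb.IsPoissonIdeal I ∧ S ⊆ I}

end PoissonBracket

open PoissonBracket

universe u v
namespace PoissonBracket

section Basic

variable {F P : Type*} [Field F] [CommRing P] [Algebra F P]

theorem skew (pb : PoissonBracket F P) (a b : P) : pb.bracket a b = - pb.bracket b a := by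
  have h := pb.alt (a + b)
  rw [pb.add_left, pb.add_right, pb.add_right, pb.alt, pb.alt] at h
  linear_combination h

theorem zero_left (pb : PoissonBracket F P) (b : P) : pb.bracket 0 b = 0 := by
  have h := pb.add_left 0 0 b
  rw [add_zero] at h
  linear_combination -h

theorem zero_right (pb : PoissonBracket F P) (b : P) : pb.bracket b 0 = 0 := by
  rw [pb.skew, pb.zero_left, neg_zero]

theorem neg_left (pb : PoissonBracket F P) (a b : P) : pb.bracket (-a) b = - pb.bracket a b := by
  have h := pb.add_left a (-a) b
  rw [add_neg_cancel, pb.zero_left] at h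
  linear_combination -h

theorem neg_right (pb : PoissonBracket F P) (a b : P) : pb.bracket a (-b) = - pb.bracket a b := by
  rw [pb.skew, pb.neg_left, pb.skew b a, neg_neg]

theorem leib_right (pb : PoissonBracket F P) (a b c : P) :
    pb.bracket a (b * c) = b * pb.bracket a c + c * pb.bracket a b := by
  rw [pb.skew, pb.leibniz, pb.skew c a, pb.skew b a]; ring

/-- The inner derivation form of the Jacobi identity. -/
theorem jac (pb : PoissonBracket F P) (a b c : P) :
    pb.bracket (pb.bracket a b) c
      = pb.bracket (pb.bracket a c) b + pb.bracket a (pb.bracket b c) := by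
  have h := pb.jacobi a b c
  rw [pb.skew c a, pb.neg_left, pb.skew (pb.bracket b c) a] at h
  linear_combination h

end Basic

/-- The situation of an abelian Lie ideal `U = {V, V}` with `{PU, P} ⊆ V`. -/
structure AbStep {F P : Type*} [Field F] [CommRing P] [Algebra F P]
    (pb : PoissonBracket F P) (U V : Submodule F P) : Prop where
  hU : ∀ u ∈ U, ∀ p, pb.bracket u p ∈ U
  hV : ∀ v ∈ V, ∀ p, pb.bracket v p ∈ V
  hab : ∀ u ∈ U, ∀ u' ∈ U, pb.bracket u u' = 0
  hVV : ∀ v ∈ V, ∀ v' ∈ V, pb.bracket v v' ∈ U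
  hPU : ∀ u ∈ U, ∀ f x, pb.bracket (f * u) x ∈ V
  hspan : U ≤ Submodule.span F {z : P | ∃ a ∈ V, ∃ b ∈ V, z = pb.bracket a b}

namespace AbStep

variable {F P : Type*} [Field F] [CommRing P] [Algebra F P]
  {pb : PoissonBracket F P} {U V : Submodule F P}

/-- The centralizer of `U` is a Lie ideal. -/
theorem cent_lie (h : AbStep pb U V) {ζ : P} (hζ : ∀ u ∈ U, pb.bracket ζ u = 0) (x : P) :
    ∀ u ∈ U, pb.bracket (pb.bracket ζ x) u = 0 := by
  intro u hu
  rw [pb.jac, hζ u hu, pb.zero_left, pb.skew x u, pb.neg_right,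
    hζ _ (h.hU u hu x)]
  simp

/-- The basic exchange relation. -/
theorem S (h : AbStep pb U V) {u ζ : P} (hu : u ∈ U) (hζ : ∀ u ∈ U, pb.bracket ζ u = 0)
    (x y : P) :
    pb.bracket u x * pb.bracket ζ y + pb.bracket u y * pb.bracket ζ x = 0 := by
  have h1 := h.cent_lie hζ (x * y) u hu
  have h2 := h.cent_lie hζ x u hu
  have h3 := h.cent_lie hζ y u hu
  rw [pb.leib_right, pb.add_left, pb.leibniz, pb.leibniz, h2, h3, pb.skew x u, pb.skew y u] at h1
  linear_combination -h1

theorem S' (h : AbStep pb U V) {u u' : P} (hu : u ∈ U) (hu' : u' ∈ U) (x y : P) :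
    pb.bracket u x * pb.bracket u' y + pb.bracket u y * pb.bracket u' x = 0 :=
  h.S hu (fun w hw => h.hab u' hu' w hw) x y

theorem VU (h : AbStep pb U V) {v z : P} (hz : z ∈ U) : pb.bracket v z ∈ U := by
  rw [pb.skew]; exact U.neg_mem (h.hU z hz v)

theorem F1 (h : AbStep pb U V) {v v' z z' : P} (hv : v ∈ V) (hv' : v' ∈ V) (hz : z ∈ U)
    (hz' : z' ∈ U) (p : P) :
    pb.bracket v' z' * pb.bracket (pb.bracket v z) p
      = pb.bracket v z' * pb.bracket (pb.bracket v' z) p := by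
  have h0 := h.hab _ (h.hVV v hv v' hv') z hz
  rw [pb.jac, pb.skew v (pb.bracket v' z)] at h0
  have h1 := h.S' hz' (h.VU (v := v) hz) p v'
  have h2 := h.S' hz' (h.VU (v := v') hz) p v
  rw [pb.skew v' z', pb.skew v z']
  linear_combination h2 - h1 + pb.bracket z' p * h0

theorem F3 (h : AbStep pb U V) {v v' z z' ζ : P} (hv : v ∈ V) (hv' : v' ∈ V) (hz : z ∈ U)
    (hz' : z' ∈ U) (hζ : ∀ u ∈ U, pb.bracket ζ u = 0) (q p : P) :
    pb.bracket v' z' * (pb.bracket ζ p * pb.bracket (pb.bracket v q) z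
      + pb.bracket v z * pb.bracket (pb.bracket ζ q) p) = 0 := by
  have key : ∀ z ∈ U, pb.bracket (pb.bracket v (ζ * q)) z
      = ζ * pb.bracket (pb.bracket v q) z + pb.bracket v z * pb.bracket ζ q := by
    intro z hz
    have e1 := h.cent_lie hζ v z hz
    have e2 := h.S hz hζ q v
    rw [pb.leib_right, pb.add_left, pb.leibniz, pb.leibniz, hζ z hz, pb.skew v ζ, pb.neg_left, e1]
    rw [pb.skew q z, pb.skew v z]
    linear_combination e2
  have a1 := h.F1 (h.hV v hv (ζ * q)) hv' hz hz' p
  have a2 := h.F1 (h.hV v hv q) hv' hz hz' p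
  have a3 := h.F1 hv hv' hz hz' p
  rw [key z hz, key z' hz', pb.add_left, pb.leibniz, pb.leibniz] at a1
  linear_combination a1 - ζ * a2 - pb.bracket ζ q * a3

theorem H (h : AbStep pb U V) {v v' w z z' ζ : P} (hv : v ∈ V) (hv' : v' ∈ V) (hw : w ∈ V)
    (hz : z ∈ U) (hz' : z' ∈ U) (hζ : ∀ u ∈ U, pb.bracket ζ u = 0) (p : P) :
    pb.bracket v' z' * pb.bracket v z * pb.bracket (pb.bracket ζ w) p = 0 := by
  have a := h.F3 hv hv' hz hz' hζ w p
  rw [h.hab _ (h.hVV v hv w hw) z hz] at a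
  linear_combination a

theorem G (h : AbStep pb U V) {a a' b b' q v1 v2 z : P} (ha : a ∈ V) (ha' : a' ∈ V)
    (hb : b ∈ U) (hb' : b' ∈ U) (hq : q ∈ V) (hv1 : v1 ∈ V) (hv2 : v2 ∈ V) (hz : z ∈ U) (p : P) :
    pb.bracket a' b' * pb.bracket a b *
      (pb.bracket q z * pb.bracket (pb.bracket v1 v2) p
        + pb.bracket v1 z * pb.bracket (pb.bracket q v2) p) = 0 := by
  have hα : ∀ u ∈ U, pb.bracket (pb.bracket q z * v1 + q * pb.bracket v1 z) u = 0 := by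
    intro u hu
    rw [pb.add_left, pb.leibniz, pb.leibniz, h.hab _ (h.VU hz) u hu, h.hab _ (h.VU hz) u hu]
    have e := h.S' hz hu q v1
    rw [pb.skew q z, pb.skew v1 z, pb.skew v1 u, pb.skew q u]
    linear_combination e
  have main := h.H ha ha' hv2 hb hb' hα p
  have cz : ∀ z ∈ U, ∀ u ∈ U, pb.bracket z u = 0 := h.hab
  have k1 : ∀ w ∈ V, ∀ x, pb.bracket a' b' * pb.bracket a b
      * pb.bracket (pb.bracket w z) x = 0 := by
    intro w hw x
    have := h.H ha ha' hw hb hb' (cz z hz) x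
    rw [pb.skew w z, pb.neg_left]
    linear_combination -this
  have k2 := h.H ha ha' hv2 hb hb' (cz _ (h.VU (v := q) hz)) p
  have k3 := h.H ha ha' hv2 hb hb' (cz _ (h.VU (v := v1) hz)) p
  have k4 := k1 q hq p
  have k5 := k1 q hq v2
  have k6 := k1 v1 hv1 p
  have k7 := k1 v1 hv1 v2
  simp only [pb.add_left, pb.leibniz] at main
  linear_combination main - v1 * k2 - q * k3 - pb.bracket v1 v2 * k4
    - pb.bracket v1 p * k5 - pb.bracket q v2 * k6 - pb.bracket q p * k7

theorem theta_swap (h : AbStep pb U V) {a a' b b' q v1 v2 z : P} (ha : a ∈ V) (ha' : a' ∈ V)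
    (hb : b ∈ U) (hb' : b' ∈ U) (hq : q ∈ V) (hv1 : v1 ∈ V) (hv2 : v2 ∈ V) (hz : z ∈ U) (p : P) :
    pb.bracket a' b' * pb.bracket a b * pb.bracket p z *
      (pb.bracket (pb.bracket v1 v2) q + pb.bracket (pb.bracket q v2) v1) = 0 := by
  have g := h.G ha ha' hb hb' hq hv1 hv2 hz p
  have s1 := h.S' hz (h.hVV v1 hv1 v2 hv2) p q
  have s2 := h.S' hz (h.hVV q hq v2 hv2) p v1
  rw [pb.skew q z, pb.skew v1 z] at g
  rw [pb.skew p z]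
  linear_combination -g - pb.bracket a' b' * pb.bracket a b * (s1 + s2)

/-- Products of the triple brackets vanish. -/
theorem theta_prod (h : AbStep pb U V) {a a' b b' z : P} (ha : a ∈ V) (ha' : a' ∈ V)
    (hb : b ∈ U) (hb' : b' ∈ U) (hz : z ∈ U) (p : P) {v1 v2 v3 v4 v5 v6 : P}
    (h1 : v1 ∈ V) (h2 : v2 ∈ V) (h3 : v3 ∈ V) (h4 : v4 ∈ V) (h5 : v5 ∈ V) (h6 : v6 ∈ V) :
    pb.bracket a' b' * pb.bracket a b * pb.bracket p z *
      (pb.bracket (pb.bracket v1 v2) v3 * pb.bracket (pb.bracket v4 v5) v6) = 0 := by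
  set W := pb.bracket a' b' * pb.bracket a b * pb.bracket p z with hW
  let θ : P → P → P → P := fun x y t => pb.bracket (pb.bracket x y) t
  have sk : ∀ x y t, θ x y t = - θ y x t := by
    intro x y t
    simp only [θ]
    rw [pb.skew x y, pb.neg_left]
  have sw : ∀ x ∈ V, ∀ y ∈ V, ∀ t ∈ V, W * θ x y t = - (W * θ t y x) := by
    intro x hx y hy t ht
    have := h.theta_swap ha ha' hb hb' ht hx hy hz p
    simp only [θ]
    linear_combination this
  have cyc : ∀ x ∈ V, ∀ y ∈ V, ∀ t ∈ V, W * θ x y t = W * θ y t x := by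
    intro x hx y hy t ht
    rw [sw x hx y hy t ht, sk t y x]; ring
  have ex : ∀ x ∈ V, ∀ y ∈ V, ∀ t ∈ V, ∀ x' ∈ V, ∀ y' ∈ V, ∀ t' ∈ V,
      W * (θ x y t * θ x' y' t') = - (W * (θ x y t' * θ x' y' t)) := by
    intro x hx y hy t ht x' hx' y' hy' t' ht'
    have := h.S' (h.hVV x hx y hy) (h.hVV x' hx' y' hy') t t'
    simp only [θ]
    linear_combination W * this
  change W * (θ v1 v2 v3 * θ v4 v5 v6) = 0
  have three : 3 * (W * (θ v1 v2 v3 * θ v4 v5 v6)) = 0 := by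
    have j : θ v1 v2 v3 + θ v2 v3 v1 + θ v3 v1 v2 = 0 := pb.jacobi v1 v2 v3
    have c1 := cyc v1 h1 v2 h2 v3 h3
    have c2 := cyc v2 h2 v3 h3 v1 h1
    linear_combination (W * j + 2 * c1 + c2) * θ v4 v5 v6
  have two : 2 * (W * (θ v1 v2 v3 * θ v4 v5 v6)) = 0 := by
    -- exchange the last entries, then rotate both factors, three times
    have e1 := ex v1 h1 v2 h2 v3 h3 v4 h4 v5 h5 v6 h6
    have r1 := cyc v1 h1 v2 h2 v6 h6
    have r1' := cyc v4 h4 v5 h5 v3 h3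
    have e2 := ex v2 h2 v6 h6 v1 h1 v5 h5 v3 h3 v4 h4
    have r2 := cyc v2 h2 v6 h6 v4 h4
    have r2' := cyc v5 h5 v3 h3 v1 h1
    have e3 := ex v6 h6 v4 h4 v2 h2 v3 h3 v1 h1 v5 h5
    have r3 := cyc v6 h6 v4 h4 v5 h5
    have r3' := cyc v3 h3 v1 h1 v2 h2
    linear_combination e1 - r1 * θ v4 v5 v3 - r1' * θ v2 v6 v1
      - e2 + r2 * θ v5 v3 v1 + r2' * θ v6 v4 v2 + e3
      - r3 * θ v3 v1 v2 - r3' * θ v4 v5 v6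
  linear_combination three - two

theorem span_zero (h : AbStep pb U V) {c w : P}
    (H0 : ∀ x ∈ V, ∀ y ∈ V, c * pb.bracket (pb.bracket x y) w = 0) :
    ∀ u ∈ U, c * pb.bracket u w = 0 := by
  intro u hu
  have hu1 := h.hspan hu
  clear hu
  induction hu1 using Submodule.span_induction with
  | zero => simp [pb.zero_left]
  | add x y hx hy ihx ihy => rw [pb.add_left, mul_add, ihx, ihy, add_zero]
  | smul r x hx ih => rw [pb.smul_left, mul_smul_comm, ih, smul_zero]
  | mem x hx =>
    obtain ⟨a, ha, b, hb, rfl⟩ := hx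
    exact H0 a ha b hb

/-- Linear extension of `theta_prod`: five factors. -/
theorem five (h : AbStep pb U V) {a a' b b' z u u' w w' : P} (ha : a ∈ V) (ha' : a' ∈ V)
    (hb : b ∈ U) (hb' : b' ∈ U) (hz : z ∈ U) (p : P) (hu : u ∈ U) (hu' : u' ∈ U)
    (hw : w ∈ V) (hw' : w' ∈ V) :
    pb.bracket a' b' * pb.bracket a b * pb.bracket p z *
      (pb.bracket u w * pb.bracket u' w') = 0 := by
  rw [← mul_assoc]
  refine h.span_zero (fun x hx y hy => ?_) u' hu'
  rw [mul_right_comm]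
  refine h.span_zero (fun x' hx' y' hy' => ?_) u hu
  rw [mul_right_comm, mul_assoc]
  exact h.theta_prod ha ha' hb hb' hz p hx' hy' hw hx hy hw'

end AbStep

section Ideals

variable {F P : Type*} [Field F] [CommRing P] [Algebra F P]

/-- The associative ideal generated by `{A, B}`. -/
def brI (pb : PoissonBracket F P) (A B : Submodule F P) : Ideal P :=
  Ideal.span {z : P | ∃ a ∈ A, ∃ b ∈ B, z = pb.bracket a b}

theorem br_mem (pb : PoissonBracket F P) {A B : Submodule F P} {a b : P} (ha : a ∈ A)
    (hb : b ∈ B) : pb.bracket a b ∈ pb.brI A B :=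
  Ideal.subset_span ⟨a, ha, b, hb, rfl⟩

theorem br_mem_top (pb : PoissonBracket F P) {A : Submodule F P} {a : P} (ha : a ∈ A)
    (b : P) : pb.bracket a b ∈ pb.brI A ⊤ :=
  pb.br_mem ha Submodule.mem_top

theorem AbStep.L5 {pb : PoissonBracket F P} {U V : Submodule F P} (h : AbStep pb U V) :
    pb.brI U V ^ 5 = ⊥ := by
  rw [brI, show (5 : ℕ) = 1 + 1 + 1 + 1 + 1 from rfl]
  simp only [pow_add, pow_one, Ideal.span_mul_span']
  rw [Ideal.span_eq_bot]
  intro x hx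
  simp only [Set.mem_mul] at hx
  obtain ⟨_, ⟨_, ⟨_, ⟨_, ⟨b1, hb1, a1, ha1, rfl⟩, _, ⟨b2, hb2, a2, ha2, rfl⟩, rfl⟩,
    _, ⟨z, hz, p, hp, rfl⟩, rfl⟩, _, ⟨u, hu, w, hw, rfl⟩, rfl⟩, _, ⟨u', hu', w', hw', rfl⟩, rfl⟩ := hx
  have := h.five ha2 ha1 hb2 hb1 hz p hu hu' hw hw'
  rw [pb.skew a1 b1, pb.skew a2 b2, pb.skew p z] at this
  linear_combination -this

theorem AbStep.Q3 {pb : PoissonBracket F P} {U V : Submodule F P} (h : AbStep pb U V) :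
    pb.brI U ⊤ ^ 3 ≤ pb.brI U V := by
  conv_lhs => rw [brI, show (3 : ℕ) = 1 + 1 + 1 from rfl]
  simp only [pow_add, pow_one, Ideal.span_mul_span']
  rw [Ideal.span_le]
  intro x hx
  simp only [Set.mem_mul] at hx
  obtain ⟨_, ⟨_, ⟨u0, hu0, y, -, rfl⟩, _, ⟨z, hz, f, -, rfl⟩, rfl⟩, _, ⟨u', hu', x, -, rfl⟩, rfl⟩ := hx
  have hu := h.hU u0 hu0 y
  generalize pb.bracket u0 y = u at hu
  have e1 : pb.bracket z (pb.bracket (f * u * u') x) ∈ pb.brI U V :=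
    pb.br_mem hz (h.hPU u' hu' (f * u) x)
  have e2 : pb.bracket z (pb.bracket (f * u) x) ∈ pb.brI U V :=
    pb.br_mem hz (h.hPU u hu f x)
  have e3 := (pb.brI U V).sub_mem e1 ((pb.brI U V).mul_mem_left u' e2)
  have c1 := h.hab z hz u hu
  have c2 := h.hab z hz u' hu'
  have c3 := h.hab z hz _ (h.hU u hu x)
  have c4 := h.hab z hz _ (h.hU u' hu' x)
  have : u * pb.bracket z f * pb.bracket u' x = pb.bracket z (pb.bracket (f * u * u') x)
      - u' * pb.bracket z (pb.bracket (f * u) x) := by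
    simp only [pb.leibniz, pb.add_right, pb.leib_right, c1, c2, c3, c4]
    ring
  change _ ∈ pb.brI U V
  rw [this]
  exact e3

theorem AbStep.Q15 {pb : PoissonBracket F P} {U V : Submodule F P} (h : AbStep pb U V) :
    pb.brI U ⊤ ^ 15 = ⊥ := by
  rw [show (15 : ℕ) = 3 * 5 from rfl, pow_mul, eq_bot_iff, ← h.L5]
  exact Ideal.pow_right_mono h.Q3 5

/-- Lie ideals. -/
def IsLie (pb : PoissonBracket F P) (A : Submodule F P) : Prop :=
  ∀ a ∈ A, ∀ p, pb.bracket a p ∈ A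

theorem IsLie.span {pb : PoissonBracket F P} {A : Submodule F P} (h : pb.IsLie A) :
    ∀ x ∈ Ideal.span (A : Set P), ∀ p, pb.bracket x p ∈ Ideal.span (A : Set P) := by
  intro x hx p
  induction hx using Submodule.span_induction with
  | zero => rw [pb.zero_left]; exact Ideal.zero_mem _
  | add x y hx hy ihx ihy => rw [pb.add_left]; exact Ideal.add_mem _ ihx ihy
  | smul r x hx ih =>
    rw [smul_eq_mul, pb.leibniz]
    exact Ideal.add_mem _ (Ideal.mul_mem_left _ _ ih) (Ideal.mul_mem_right _ _ hx)
  | mem x hx => exact Ideal.subset_span (h x hx p)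

theorem IsLie.brI {pb : PoissonBracket F P} {A : Submodule F P} (h : pb.IsLie A) :
    ∀ x ∈ pb.brI A ⊤, ∀ p, pb.bracket x p ∈ pb.brI A ⊤ := by
  intro x hx p
  have hx0 := hx
  rw [PoissonBracket.brI] at hx
  induction hx using Submodule.span_induction with
  | zero => rw [pb.zero_left]; exact Ideal.zero_mem _
  | add x y hx hy ihx ihy => rw [pb.add_left]; exact Ideal.add_mem _ (ihx hx) (ihy hy)
  | smul r x hx ih =>
    rw [smul_eq_mul, pb.leibniz]
    exact Ideal.add_mem _ (Ideal.mul_mem_left _ _ (ih hx)) (Ideal.mul_mem_right _ _ hx)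
  | mem x hx =>
    obtain ⟨a, ha, b, -, rfl⟩ := hx
    rw [pb.jac]
    exact Ideal.add_mem _ (pb.br_mem_top (h a ha p) _) (pb.br_mem_top ha _)

theorem mem_lieSpan (pb : PoissonBracket F P) {A B : Submodule F P} {a b : P} (ha : a ∈ A)
    (hb : b ∈ B) : pb.bracket a b ∈ pb.lieSpan A B :=
  Submodule.subset_span ⟨a, ha, b, hb, rfl⟩

theorem IsLie.lieSpan {pb : PoissonBracket F P} {A : Submodule F P} (h : pb.IsLie A) :
    pb.IsLie (pb.lieSpan A A) := by
  intro x hx p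
  have hx0 := hx
  rw [PoissonBracket.lieSpan] at hx
  induction hx using Submodule.span_induction with
  | zero => rw [pb.zero_left]; exact Submodule.zero_mem _
  | add x y hx hy ihx ihy => rw [pb.add_left]; exact Submodule.add_mem _ (ihx hx) (ihy hy)
  | smul r x hx ih => rw [pb.smul_left]; exact Submodule.smul_mem _ _ (ih hx)
  | mem x hx =>
    obtain ⟨a, ha, b, hb, rfl⟩ := hx
    rw [pb.jac]
    exact Submodule.add_mem _ (pb.mem_lieSpan (h a ha p) hb) (pb.mem_lieSpan ha (h b hb p))

theorem IsLie.lieSpan_le {pb : PoissonBracket F P} {A : Submodule F P} (h : pb.IsLie A) :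
    pb.lieSpan A A ≤ A := by
  refine Submodule.span_le.2 ?_
  rintro _ ⟨a, ha, b, -, rfl⟩
  exact h a ha b

/-- Herstein's trick. -/
theorem IsLie.herstein {pb : PoissonBracket F P} {A : Submodule F P} (h : pb.IsLie A) :
    ∀ u ∈ pb.lieSpan A A, ∀ f x, pb.bracket (f * u) x ∈ A := by
  have hmul : ∀ a b : P, (∀ x, pb.bracket a x ∈ A) → (∀ x, pb.bracket b x ∈ A) →
      ∀ x, pb.bracket (a * b) x ∈ A := by
    intro a b ha hb x
    have e : pb.bracket (a * b) x = pb.bracket a (b * x) + pb.bracket b (a * x) := by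
      rw [pb.leibniz, pb.leib_right, pb.leib_right, pb.skew b a]; ring
    rw [e]
    exact A.add_mem (ha _) (hb _)
  intro u hu f x
  rw [PoissonBracket.lieSpan] at hu
  induction hu using Submodule.span_induction with
  | zero => rw [mul_zero, pb.zero_left]; exact Submodule.zero_mem _
  | add x y hx hy ihx ihy => rw [mul_add, pb.add_left]; exact Submodule.add_mem _ ihx ihy
  | smul r x hx ih => rw [mul_smul_comm, pb.smul_left]; exact Submodule.smul_mem _ _ ih
  | mem u hu =>
    obtain ⟨a, ha, b, hb, rfl⟩ := hu
    have e : f * pb.bracket a b = pb.bracket a (b * f) + -(b * pb.bracket a f) := by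
      rw [pb.leib_right]; ring
    rw [e, pb.add_left, pb.neg_left]
    exact A.add_mem (h _ (h a ha _) _) (A.neg_mem (hmul b _ (h b hb) (h _ (h a ha f)) x))

theorem dseries_lie (pb : PoissonBracket F P) (n : ℕ) : pb.IsLie (pb.dseries ⊤ n) := by
  induction n with
  | zero => intro a _ p; exact Submodule.mem_top
  | succ n ih => exact ih.lieSpan

theorem dseries_anti (pb : PoissonBracket F P) : Antitone (pb.dseries ⊤) :=
  antitone_nat_of_succ_le fun n => (pb.dseries_lie n).lieSpan_le

theorem abStep (pb : PoissonBracket F P) (n : ℕ) (hn : pb.dseries ⊤ (n + 2) = ⊥) :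
    AbStep pb (pb.dseries ⊤ (n + 1)) (pb.dseries ⊤ n) where
  hU := pb.dseries_lie (n + 1)
  hV := pb.dseries_lie n
  hab u hu u' hu' := by
    have : pb.bracket u u' ∈ pb.dseries ⊤ (n + 2) := pb.mem_lieSpan hu hu'
    rwa [hn, Submodule.mem_bot] at this
  hVV v hv v' hv' := pb.mem_lieSpan hv hv'
  hPU := (pb.dseries_lie n).herstein
  hspan := le_rfl

/-- Products of two elements of `δₙ₊₁` times `{δ₂, P}` lie in the ideal of `{δₙ₊₁, P}`. -/
theorem cc_mem (pb : PoissonBracket F P) (n : ℕ) {c c' d : P} (hc : c ∈ pb.dseries ⊤ (n + 1))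
    (hc' : c' ∈ pb.dseries ⊤ (n + 1)) (hd : d ∈ pb.dseries ⊤ 2) (x : P) :
    c * c' * pb.bracket d x ∈ pb.brI (pb.dseries ⊤ (n + 1)) ⊤ := by
  set C := pb.dseries ⊤ (n + 1) with hC
  set R := pb.brI C ⊤ with hR
  have hCL : pb.IsLie C := pb.dseries_lie (n + 1)
  have hRb : ∀ y ∈ R, ∀ p, pb.bracket y p ∈ R := hCL.brI
  have hRb' : ∀ y ∈ R, ∀ p, pb.bracket p y ∈ R := fun y hy p => by
    rw [pb.skew]; exact R.neg_mem (hRb y hy p)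
  have hCR : ∀ c ∈ C, ∀ p, pb.bracket c p ∈ R := fun c hc p => pb.br_mem_top hc p
  -- first: cc'd is congruent to an element of C modulo R, bracket version
  have key : ∀ d ∈ pb.dseries ⊤ 2, ∀ x, pb.bracket (c * c' * d) x ∈ R := by
    intro d hd x
    change d ∈ Submodule.span F _ at hd
    induction hd using Submodule.span_induction with
    | zero => rw [mul_zero, pb.zero_left]; exact R.zero_mem
    | add y z hy hz ihy ihz => rw [mul_add, pb.add_left]; exact R.add_mem ihy ihz
    | smul r y hy ih =>
      rw [mul_smul_comm, pb.smul_left, Algebra.smul_def]; exact R.mul_mem_left _ ih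
    | mem d hd =>
      obtain ⟨s, hs, s', hs', rfl⟩ := hd
      change s ∈ Submodule.span F _ at hs
      change s' ∈ Submodule.span F _ at hs'
      induction hs using Submodule.span_induction with
      | zero => rw [pb.zero_left, mul_zero, pb.zero_left]; exact R.zero_mem
      | add y z hy hz ihy ihz =>
        rw [pb.add_left, mul_add, pb.add_left]; exact R.add_mem ihy ihz
      | smul r y hy ih =>
        rw [pb.smul_left, mul_smul_comm, pb.smul_left, Algebra.smul_def]
        exact R.mul_mem_left _ ih
      | mem s hs =>
      obtain ⟨p, -, q, -, rfl⟩ := hs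
      induction hs' using Submodule.span_induction with
      | zero => rw [pb.zero_right, mul_zero, pb.zero_left]; exact R.zero_mem
      | add y z hy hz ihy ihz =>
        rw [pb.add_right, mul_add, pb.add_left]; exact R.add_mem ihy ihz
      | smul r y hy ih =>
        rw [pb.smul_right, mul_smul_comm, pb.smul_left, Algebra.smul_def]
        exact R.mul_mem_left _ ih
      | mem s' hs' =>
      obtain ⟨p', -, q', -, rfl⟩ := hs'
      have hh := (pb.dseries_lie n).herstein
      have m1 : pb.bracket (pb.bracket (p * c) q) (pb.bracket (p' * c') q') ∈ C :=
        pb.mem_lieSpan (hh c hc p q) (hh c' hc' p' q')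
      have m2 := hCR _ m1 x
      set s := pb.bracket p q with hs
      set s' := pb.bracket p' q' with hs'
      have r1 : p * pb.bracket c q ∈ R := R.mul_mem_left _ (hCR c hc q)
      have r2 : p' * pb.bracket c' q' ∈ R := R.mul_mem_left _ (hCR c' hc' q')
      have m3 : pb.bracket (pb.bracket (p * c) q) (pb.bracket (p' * c') q')
          - c * c' * pb.bracket s s' ∈ R := by
        rw [pb.leibniz, pb.leibniz, pb.add_left, ← hs, ← hs']
        rw [pb.add_right (c * s)]
        have t1 := hRb _ r1 (p' * pb.bracket c' q' + c' * s')
        have t2 := hRb' _ r2 (c * s)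
        have t3 := hCR c hc (c' * s')
        have t5 := R.mul_mem_left (c * s') (hCR c' hc' s)
        have t6 := R.mul_mem_left s t3
        have e2 : pb.bracket (c * s) (c' * s') - c * c' * pb.bracket s s'
            = s * pb.bracket c (c' * s') - c * s' * pb.bracket c' s := by
          rw [pb.leibniz, pb.leib_right s, pb.skew s c']
          ring
        have t7 := R.sub_mem t6 t5
        rw [← e2] at t7
        convert R.add_mem (R.add_mem t1 t2) t7 using 1
        ring
      have m4 := R.sub_mem m2 (hRb _ m3 x)
      convert m4 using 1
      rw [sub_eq_add_neg (pb.bracket (pb.bracket (p * c) q) (pb.bracket (p' * c') q')),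
        pb.add_left, pb.neg_left]
      ring
  have k := key d hd x
  have t1 := R.mul_mem_left (d * c) (hCR c' hc' x)
  have t2 := R.mul_mem_left (d * c') (hCR c hc x)
  convert R.sub_mem (R.sub_mem k t1) t2 using 1
  simp only [pb.leibniz]
  ring

theorem K3 (pb : PoissonBracket F P) (n : ℕ) (hn : 2 ≤ n) :
    Ideal.span (pb.dseries ⊤ (n + 1) : Set P) ^ 3 ≤ pb.brI (pb.dseries ⊤ (n + 1)) ⊤ := by
  have h1 : Ideal.span (pb.dseries ⊤ (n + 1) : Set P) ≤ pb.brI (pb.dseries ⊤ 2) ⊤ := by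
    rw [Ideal.span_le]
    intro x hx
    change x ∈ Submodule.span F _ at hx
    change x ∈ pb.brI (pb.dseries ⊤ 2) ⊤
    induction hx using Submodule.span_induction with
    | zero => exact Ideal.zero_mem _
    | add y z hy hz ihy ihz => exact Ideal.add_mem _ ihy ihz
    | smul r y hy ih => rw [Algebra.smul_def]; exact Ideal.mul_mem_left _ _ ih
    | mem x hx =>
      obtain ⟨a, ha, b, hb, rfl⟩ := hx
      exact pb.br_mem_top (pb.dseries_anti hn ha) b
  calc Ideal.span (pb.dseries ⊤ (n + 1) : Set P) ^ 3
      = Ideal.span (pb.dseries ⊤ (n + 1) : Set P) * Ideal.span (pb.dseries ⊤ (n + 1) : Set P)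
        * Ideal.span (pb.dseries ⊤ (n + 1) : Set P) := by ring
    _ ≤ Ideal.span (pb.dseries ⊤ (n + 1) : Set P) * Ideal.span (pb.dseries ⊤ (n + 1) : Set P)
        * pb.brI (pb.dseries ⊤ 2) ⊤ := Ideal.mul_mono_right h1
    _ ≤ _ := by
      conv_lhs => rw [brI]
      rw [Ideal.span_mul_span', Ideal.span_mul_span', Ideal.span_le]
      intro x hx
      simp only [Set.mem_mul] at hx
      obtain ⟨_, ⟨c, hc, c', hc', rfl⟩, _, ⟨d, hd, y, -, rfl⟩, rfl⟩ := hx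
      exact pb.cc_mem n hc hc' hd y

/-- The quotient Poisson bracket. -/
noncomputable def quot (pb : PoissonBracket F P) (K : Ideal P)
    (hK : ∀ x ∈ K, ∀ p, pb.bracket x p ∈ K) : PoissonBracket F (P ⧸ K) := by
  have hK' : ∀ x ∈ K, ∀ p, pb.bracket p x ∈ K := fun y hy p => by
    rw [pb.skew]; exact K.neg_mem (hK y hy p)
  have wd : ∀ a₁ b₁ a₂ b₂ : P, (Submodule.quotientRel K) a₁ a₂ → (Submodule.quotientRel K) b₁ b₂ →
      Ideal.Quotient.mk K (pb.bracket a₁ b₁) = Ideal.Quotient.mk K (pb.bracket a₂ b₂) := by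
    intro a₁ b₁ a₂ b₂ ha hb
    rw [Submodule.quotientRel_def] at ha hb
    rw [Ideal.Quotient.mk_eq_mk_iff_sub_mem]
    have e : pb.bracket a₁ b₁ - pb.bracket a₂ b₂
        = pb.bracket (a₁ - a₂) b₁ + pb.bracket a₂ (b₁ - b₂) := by
      rw [sub_eq_add_neg, sub_eq_add_neg, sub_eq_add_neg, pb.add_left, pb.add_right,
        pb.neg_left, pb.neg_right]
      ring
    rw [e]
    exact K.add_mem (hK _ ha _) (hK' _ hb _)
  let B : P ⧸ K → P ⧸ K → P ⧸ K :=
    Quotient.lift₂ (fun a b => Ideal.Quotient.mk K (pb.bracket a b)) wd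
  have hB : ∀ a b, B (Ideal.Quotient.mk K a) (Ideal.Quotient.mk K b)
      = Ideal.Quotient.mk K (pb.bracket a b) := fun a b => rfl
  have sur := Ideal.Quotient.mk_surjective (I := K)
  have hs : ∀ (r : F) (a : P), r • Ideal.Quotient.mk K a = Ideal.Quotient.mk K (r • a) :=
    fun r a => rfl
  exact
  { bracket := B
    add_left := by
      intro a b c
      obtain ⟨a, rfl⟩ := sur a
      obtain ⟨b, rfl⟩ := sur b
      obtain ⟨c, rfl⟩ := sur c
      rw [← map_add, hB, hB, hB, pb.add_left, map_add]
    smul_left := by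
      intro r a b
      obtain ⟨a, rfl⟩ := sur a
      obtain ⟨b, rfl⟩ := sur b
      rw [hs, hB, hB, hs, pb.smul_left]
    add_right := by
      intro a b c
      obtain ⟨a, rfl⟩ := sur a
      obtain ⟨b, rfl⟩ := sur b
      obtain ⟨c, rfl⟩ := sur c
      rw [← map_add, hB, hB, hB, pb.add_right, map_add]
    smul_right := by
      intro r a b
      obtain ⟨a, rfl⟩ := sur a
      obtain ⟨b, rfl⟩ := sur b
      rw [hs, hB, hB, hs, pb.smul_right]
    alt := by
      intro a
      obtain ⟨a, rfl⟩ := sur a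
      rw [hB, pb.alt, map_zero]
    jacobi := by
      intro a b c
      obtain ⟨a, rfl⟩ := sur a
      obtain ⟨b, rfl⟩ := sur b
      obtain ⟨c, rfl⟩ := sur c
      simp only [hB]
      rw [← map_add, ← map_add, pb.jacobi, map_zero]
    leibniz := by
      intro a b c
      obtain ⟨a, rfl⟩ := sur a
      obtain ⟨b, rfl⟩ := sur b
      obtain ⟨c, rfl⟩ := sur c
      rw [← map_mul, hB, hB, hB, pb.leibniz, map_add, map_mul, map_mul] }

theorem quot_mk (pb : PoissonBracket F P) (K : Ideal P)
    (hK : ∀ x ∈ K, ∀ p, pb.bracket x p ∈ K) (a b : P) :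
    (pb.quot K hK).bracket (Ideal.Quotient.mk K a) (Ideal.Quotient.mk K b)
      = Ideal.Quotient.mk K (pb.bracket a b) := rfl

theorem quot_dseries (pb : PoissonBracket F P) (K : Ideal P)
    (hK : ∀ x ∈ K, ∀ p, pb.bracket x p ∈ K) (n : ℕ) :
    (pb.quot K hK).dseries ⊤ n
      = (pb.dseries ⊤ n).map (Ideal.Quotient.mkₐ F K).toLinearMap := by
  induction n with
  | zero =>
    simp only [dseries]
    rw [Submodule.map_top, eq_comm, LinearMap.range_eq_top]
    exact Ideal.Quotient.mk_surjective
  | succ n ih =>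
    simp only [dseries, lieSpan]
    rw [ih, Submodule.map_span]
    congr 1
    ext x
    constructor
    · rintro ⟨_, ⟨a, ha, rfl⟩, _, ⟨b, hb, rfl⟩, rfl⟩
      exact ⟨_, ⟨a, ha, b, hb, rfl⟩, rfl⟩
    · rintro ⟨_, ⟨a, ha, b, hb, rfl⟩, rfl⟩
      exact ⟨_, ⟨a, ha, rfl⟩, _, ⟨b, hb, rfl⟩, rfl⟩

theorem quot_brI (pb : PoissonBracket F P) (K : Ideal P)
    (hK : ∀ x ∈ K, ∀ p, pb.bracket x p ∈ K) (n : ℕ) :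
    (pb.brI (pb.dseries ⊤ n) ⊤).map (Ideal.Quotient.mk K)
      ≤ (pb.quot K hK).brI ((pb.quot K hK).dseries ⊤ n) ⊤ := by
  rw [Ideal.map_le_iff_le_comap]
  conv_lhs => rw [brI]
  rw [Ideal.span_le]
  rintro _ ⟨a, ha, b, -, rfl⟩
  change Ideal.Quotient.mk K (pb.bracket a b) ∈
    (pb.quot K hK).brI ((pb.quot K hK).dseries ⊤ n) ⊤
  rw [← pb.quot_mk K hK]
  refine br_mem_top _ ?_ _
  rw [quot_dseries]
  exact ⟨a, ha, rfl⟩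

end Ideals

theorem pow_helper {P : Type*} [CommRing P] {I K : Ideal P} {t m : ℕ} (h : I ^ t ≤ K)
    (hK : K ^ m = ⊥) : I ^ (t * m) = ⊥ := by
  have e3 := Ideal.pow_right_mono h m
  rw [hK, ← pow_mul] at e3
  exact le_bot_iff.1 e3

theorem main_aux (n : ℕ) : ∃ t : ℕ, 0 < t ∧
    ∀ (F : Type u) (P : Type v) [Field F] [CommRing P] [Algebra F P] (pb : PoissonBracket F P),
      pb.dseries ⊤ (n + 2) = ⊥ → pb.brI (pb.dseries ⊤ 2) ⊤ ^ t = ⊥ := by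
  induction n with
  | zero =>
    refine ⟨1, one_pos, fun F P _ _ _ pb h => ?_⟩
    rw [pow_one, brI, Ideal.span_eq_bot]
    rintro _ ⟨a, ha, b, -, rfl⟩
    rw [h, Submodule.mem_bot] at ha
    rw [ha, pb.zero_left]
  | succ n ih =>
    obtain ⟨t, ht, ih⟩ := ih
    rcases Nat.eq_zero_or_pos n with rfl | hn
    · exact ⟨15, by norm_num, fun F P _ _ _ pb h => (pb.abStep 1 h).Q15⟩
    refine ⟨t * 45, by positivity, fun F P _ _ _ pb h => ?_⟩
    have q := (pb.abStep (n + 1) h).Q15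
    have k := pb.K3 (n + 1) (by omega)
    have hL := (pb.dseries_lie (n + 2)).span
    set K := Ideal.span (pb.dseries ⊤ (n + 2) : Set P) with hKdef
    have k45 : K ^ 45 = ⊥ := by
      rw [show (45 : ℕ) = 3 * 15 from rfl, pow_mul, eq_bot_iff, ← q]
      exact Ideal.pow_right_mono k 15
    have hq : (pb.quot K hL).dseries ⊤ (n + 2) = ⊥ := by
      rw [quot_dseries, eq_bot_iff, Submodule.map_le_iff_le_comap]
      intro x hx
      exact Ideal.Quotient.eq_zero_iff_mem.2 (Ideal.subset_span hx)
    have e := ih F (P ⧸ K) (pb.quot K hL) hq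
    have e2 : pb.brI (pb.dseries ⊤ 2) ⊤ ^ t ≤ K := by
      have : (pb.brI (pb.dseries ⊤ 2) ⊤ ^ t).map (Ideal.Quotient.mk K) ≤ ⊥ := by
        rw [Ideal.map_pow, ← e]
        exact Ideal.pow_right_mono (pb.quot_brI K hL 2) t
      rw [Ideal.map_le_iff_le_comap] at this
      intro x hx
      exact Ideal.Quotient.eq_zero_iff_mem.1 (this hx)
    exact pow_helper e2 k45

theorem pow_le_restrict {F P : Type*} [Field F] [CommRing P] [Algebra F P]
    {J : Submodule F P} {I : Ideal P} (h : J ≤ I.restrictScalars F) (t : ℕ) :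
    J ^ t ≤ (I ^ t).restrictScalars F := by
  induction t with
  | zero => intro x _; simp
  | succ t ih =>
    rw [pow_succ, Submodule.mul_le]
    intro a ha b hb
    rw [Submodule.restrictScalars_mem, pow_succ]
    exact Ideal.mul_mem_mul (ih ha) (h hb)

end PoissonBracket


/-- If `P` is solvable of derived length `n`, then the Poisson ideal generated by all
elements `{{{x₁,x₂},{x₃,x₄}},x₅}` is associative nilpotent of index bounded by a
function depending only on `n`. -/
theorem solvable_poissonSpan_nilpotent :
    ∀ n : ℕ, ∃ t : ℕ, 0 < t ∧
      ∀ (F : Type u) (P : Type v) [Field F] [CommRing P] [Algebra F P]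
        (pb : PoissonBracket F P),
        pb.dseries ⊤ n = ⊥ → (∀ m < n, pb.dseries ⊤ m ≠ ⊥) →
        pb.poissonSpan {z : P | ∃ x1 x2 x3 x4 x5 : P,
            z = pb.bracket (pb.bracket (pb.bracket x1 x2) (pb.bracket x3 x4)) x5} ^ t = ⊥ := by
  intro n
  obtain ⟨t, ht, H⟩ := PoissonBracket.main_aux.{u, v} n
  refine ⟨t, ht, fun F P _ _ _ pb h _ => ?_⟩
  have h2 : pb.dseries ⊤ (n + 2) = ⊥ := by
    rw [eq_bot_iff, ← h]
    exact pb.dseries_anti (by omega)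
  have e := H F P pb h2
  have hL := (pb.dseries_lie 2).brI
  have hJ : pb.poissonSpan {z : P | ∃ x1 x2 x3 x4 x5 : P,
      z = pb.bracket (pb.bracket (pb.bracket x1 x2) (pb.bracket x3 x4)) x5}
      ≤ (pb.brI (pb.dseries ⊤ 2) ⊤).restrictScalars F := by
    refine sInf_le ⟨⟨fun x hx p => Ideal.mul_mem_left _ _ hx, fun x hx p => hL x hx p⟩, ?_⟩
    rintro _ ⟨x1, x2, x3, x4, x5, rfl⟩
    refine pb.br_mem_top ?_ _
    exact pb.mem_lieSpan (pb.mem_lieSpan Submodule.mem_top Submodule.mem_top)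
      (pb.mem_lieSpan Submodule.mem_top Submodule.mem_top)
  rw [eq_bot_iff]
  refine (pow_le_restrict hJ t).trans ?_
  rw [e]
  intro x hx
  exact hx
end

section
/- Let P be a Poisson algebra over a field 𝔽. Then for every positive integer k, (δ̃₁(P))^{2^k − 1} ⊆ δ̃ₖ(P), i.e. every product of 2^k − 1 elements of the Poisson ideal {P,P}·P lies in the k-th term of the upper derived series of P. -/
open PoissonBracket

theorem top_mul_top_aux {F P : Type*} [Field F] [CommRing P] [Algebra F P] :
    (⊤ : Submodule F P) * ⊤ = ⊤ := by
  refine top_le_iff.1 fun x _ => ?_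
  simpa using Submodule.mul_mem_mul (Submodule.mem_top (R := F) (x := x))
    (Submodule.mem_top (R := F) (x := (1 : P)))

theorem udelta_mul_top {F P : Type*} [Field F] [CommRing P] [Algebra F P]
    (pb : PoissonBracket F P) (n : ℕ) : pb.udelta n * ⊤ ≤ pb.udelta n := by
  cases n with
  | zero => exact le_top
  | succ n => rw [udelta, mul_assoc, top_mul_top_aux]

theorem leibniz_right {F P : Type*} [Field F] [CommRing P] [Algebra F P]
    (pb : PoissonBracket F P) (a b c : P) :
    pb.bracket c (a * b) = a * pb.bracket c b + b * pb.bracket c a := by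
  have anti : ∀ x y, pb.bracket x y = - pb.bracket y x := fun x y => by
    have h := pb.alt (x + y)
    rw [pb.add_left, pb.add_right, pb.add_right, pb.alt, pb.alt] at h
    linear_combination h
  rw [anti, pb.leibniz, anti c b, anti c a]; ring

theorem udelta_step {F P : Type*} [Field F] [CommRing P] [Algebra F P]
    (pb : PoissonBracket F P) (n : ℕ) :
    pb.udelta 1 * (pb.udelta n * pb.udelta n) ≤ pb.udelta (n + 1) := by
  have idl : ∀ m, ∀ a ∈ pb.udelta m, ∀ x, a * x ∈ pb.udelta m := fun m a ha x =>
    udelta_mul_top pb m (Submodule.mul_mem_mul ha Submodule.mem_top)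
  have br : ∀ a ∈ pb.udelta n, ∀ b ∈ pb.udelta n, pb.bracket a b ∈ pb.udelta (n + 1) := by
    intro a ha b hb
    have h := Submodule.mul_mem_mul (M := pb.lieSpan (pb.udelta n) (pb.udelta n))
      (Submodule.subset_span ⟨a, ha, b, hb, rfl⟩) (Submodule.mem_top (R := F) (x := (1 : P)))
    rw [mul_one] at h
    exact h
  have h1 : ∀ a ∈ pb.udelta n, ∀ b ∈ pb.udelta n, ∀ x,
      a * pb.bracket x b ∈ pb.udelta (n + 1) := by
    intro a ha b hb x
    have h := sub_mem (br _ (idl n a ha x) b hb) (idl (n + 1) _ (br a ha b hb) x)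
    rw [pb.leibniz] at h
    convert h using 1; ring
  have h2 : ∀ a ∈ pb.udelta n, ∀ b ∈ pb.udelta n, ∀ x y,
      pb.bracket x y * (a * b) ∈ pb.udelta (n + 1) := by
    intro a ha b hb x y
    have h := sub_mem (h1 a ha _ (idl n b hb y) x) (idl (n + 1) _ (h1 a ha b hb x) y)
    rw [leibniz_right] at h
    convert h using 1; ring
  have h3 : pb.lieSpan ⊤ ⊤ * (pb.udelta n * pb.udelta n) ≤ pb.udelta (n + 1) := by
    rw [Submodule.mul_le]
    intro d hd c hc
    induction hc using Submodule.mul_induction_on' with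
    | add u _ v _ hu hv => rw [mul_add]; exact add_mem hu hv
    | mem_mul_mem a ha b hb =>
      induction hd using Submodule.span_induction with
      | mem z hz => obtain ⟨x, -, y, -, rfl⟩ := hz; exact h2 a ha b hb x y
      | zero => rw [zero_mul]; exact zero_mem _
      | add u v _ _ hu hv => rw [add_mul]; exact add_mem hu hv
      | smul r u _ hu => rw [smul_mul_assoc]; exact Submodule.smul_mem _ r hu
  calc pb.udelta 1 * (pb.udelta n * pb.udelta n)
      = (pb.lieSpan ⊤ ⊤ * (pb.udelta n * pb.udelta n)) * ⊤ := by
        rw [show pb.udelta 1 = pb.lieSpan ⊤ ⊤ * ⊤ from rfl, mul_right_comm]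
    _ ≤ pb.udelta (n + 1) * ⊤ := mul_le_mul' h3 le_rfl
    _ ≤ _ := udelta_mul_top pb _

/-- For every positive integer `k`, `(δ̃₁(P))^(2^k - 1) ⊆ δ̃ₖ(P)`. -/
theorem udeltaOne_pow_le_udelta
    {F P : Type*} [Field F] [CommRing P] [Algebra F P]
    (pb : PoissonBracket F P) :
    ∀ k : ℕ, 1 ≤ k → pb.udelta 1 ^ (2 ^ k - 1) ≤ pb.udelta k := by
  intro k _
  clear * -
  induction k with
  | zero => exact le_top
  | succ k ih =>
    have e : 2 ^ (k + 1) - 1 = 1 + ((2 ^ k - 1) + (2 ^ k - 1)) := by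
      have := Nat.one_le_two_pow (n := k)
      omega
    rw [e, pow_add, pow_add, pow_one]
    exact (mul_le_mul' le_rfl (mul_le_mul' ih ih)).trans (udelta_step pb k)
end
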